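/- Let P ∈ 𝒫. Then the set of all U ∈ U₂ satisfying rank(U − 𝔠((1/2)P)) ≤ 1, rank(U − 𝔠((1/2)P⊥)) ≤ 1, and rank(U − 𝔠(I)) ≤ 1 equals the set {𝔠(Q + (1/3)Q⊥) : Q ∈ 𝒫 and tr(P·Q) = 1/2}. -/

import Mathlib

open Matrix
open scoped ComplexOrder

noncomputable section

/-- The space of `2×2` complex matrices. -/
abbrev Mat2 : Type := Matrix (Fin 2) (Fin 2) ℂ

/-- The group of `2×2` complex unitary matrices. -/
abbrev U2 : Type := Matrix.unitaryGroup (Fin 2) ℂ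

/-- Coherency for matrices: `A ∼ B` iff `rank (A − B) ≤ 1`. -/
def Coherent (A B : Mat2) : Prop := (A - B).rank ≤ 1

/-- Coherency for unitaries: `U ∼ V` iff `rank (U − V) ≤ 1`. -/
def CoherentU (U V : U2) : Prop := ((U : Mat2) - (V : Mat2)).rank ≤ 1

/-- The Cayley transform, as a matrix: `𝔠(A) = (A − iI)(A + iI)⁻¹`. -/
def cayleyMat (A : Mat2) : Mat2 :=
  (A - Complex.I • (1 : Mat2)) * (A + Complex.I • (1 : Mat2))⁻¹

open Classical in
/-- The Cayley transform, landing in the unitary group.  For every hermitian `A` the matrix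
`cayleyMat A` is unitary, so the junk value `1` is never used for the matrices considered here. -/
def cayley (A : Mat2) : U2 :=
  if h : cayleyMat A ∈ Matrix.unitaryGroup (Fin 2) ℂ then ⟨cayleyMat A, h⟩ else 1

/-- An automorphism of `U₂`: a bijection preserving coherency in both directions. -/
def IsAut (Φ : U2 → U2) : Prop :=
  Function.Bijective Φ ∧ ∀ U V : U2, CoherentU U V ↔ CoherentU (Φ U) (Φ V)

/-- A line in `U₂`: a maximal subset all of whose elements are pairwise coherent. -/
def IsLine (ℓ : Set U2) : Prop :=
  (∀ U ∈ ℓ, ∀ V ∈ ℓ, CoherentU U V) ∧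
  ∀ m : Set U2, ℓ ⊆ m → (∀ U ∈ m, ∀ V ∈ m, CoherentU U V) → m = ℓ

/-- The matrix interval `[A, B] = {X : A ≤ X ≤ B}` (in the Loewner order). -/
def matIcc (A B : Mat2) : Set Mat2 := {X | (X - A).PosSemidef ∧ (B - X).PosSemidef}

/-- Rank one projections: `P = P* = P²` of rank one. -/
def IsProj1 (P : Mat2) : Prop := P.IsHermitian ∧ P * P = P ∧ P.rank = 1

lemma eq_zero_of_rank_eq_zero {A : Mat2} (h : A.rank = 0) : A = 0 := by
  have hlin : A.mulVecLin = 0 := LinearMap.range_eq_bot.mp (Submodule.finrank_eq_zero.mp h)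
  apply Matrix.mulVec_injective
  funext v
  simpa using LinearMap.congr_fun hlin v

/-- A `2×2` matrix has rank at most one exactly when it is singular. -/
lemma rank_le_one_iff_det_eq_zero (A : Mat2) : A.rank ≤ 1 ↔ A.det = 0 := by
  constructor
  · intro h
    by_contra hd
    have := Matrix.rank_of_det_ne_zero hd
    simp at this
    omega
  · intro h
    have hadj : A * A.adjugate = 0 := by rw [Matrix.mul_adjugate, h, zero_smul]
    have hsum := Matrix.rank_add_rank_le_card_of_mul_eq_zero hadj
    simp only [Fintype.card_fin] at hsum
    by_contra hr
    have hadj0 : A.adjugate = 0 := eq_zero_of_rank_eq_zero (by omega)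
    have hA : A = 0 := by
      have h2 := Matrix.adjugate_adjugate A (by simp)
      simpa [hadj0] using h2.symm
    simp [hA] at hr

/-- A rank-one projection is singular. -/
lemma IsProj1.det_eq_zero {P : Mat2} (hP : IsProj1 P) : P.det = 0 :=
  (rank_le_one_iff_det_eq_zero P).mp hP.2.2.le

lemma mul_self_eq_of_det_eq_zero {P : Mat2} (hd : P.det = 0) : P * P = P.trace • P := by
  rw [Matrix.det_fin_two] at hd
  rw [Matrix.trace_fin_two]
  ext i j
  fin_cases i <;> fin_cases j <;> simp [Matrix.mul_apply, Fin.sum_univ_two] <;>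
    first | ring1 | linear_combination (-1 : ℂ) * hd

/-- A rank-one projection has trace one. -/
lemma IsProj1.trace_eq_one {P : Mat2} (hP : IsProj1 P) : P.trace = 1 := by
  have h := mul_self_eq_of_det_eq_zero hP.det_eq_zero
  have hne : P ≠ 0 := by
    rintro rfl
    simpa using hP.2.2
  rw [hP.2.1] at h
  have h0 : (P.trace - 1) • P = 0 := by rw [sub_smul, one_smul, ← h, sub_self]
  exact sub_eq_zero.mp ((smul_eq_zero.mp h0).resolve_right hne)

lemma isProj1_of_trace_det {Q : Mat2} (hh : Q.IsHermitian) (ht : Q.trace = 1)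
    (hd : Q.det = 0) : IsProj1 Q := by
  refine ⟨hh, by rw [mul_self_eq_of_det_eq_zero hd, ht, one_smul], ?_⟩
  refine le_antisymm ((rank_le_one_iff_det_eq_zero Q).mpr hd) ?_
  rw [Nat.one_le_iff_ne_zero]
  intro h0
  simp [eq_zero_of_rank_eq_zero h0] at ht

/-- Matrices diagonal with respect to `R`, `1 - R` multiply coefficientwise. -/
lemma smul_add_smul_compl_mul {R : Mat2} (hR : R * R = R) (a b c d : ℂ) :
    (a • R + b • (1 - R)) * (c • R + d • (1 - R)) = (a * c) • R + (b * d) • (1 - R) := by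
  have h1 : R * (1 - R) = 0 := by rw [mul_sub, hR, mul_one, sub_self]
  have h2 : (1 - R) * R = 0 := by rw [sub_mul, hR, one_mul, sub_self]
  have h3 : (1 - R) * (1 - R) = 1 - R := by rw [mul_sub, h2, mul_one, sub_zero]
  simp only [add_mul, mul_add, smul_mul_assoc, mul_smul_comm, h1, h2, h3, hR, smul_zero, smul_smul,
    add_zero, zero_add, mul_comm]

/-- The Cayley transform acts on the spectral decomposition of a hermitian matrix. -/
lemma coe_cayley_smul_add_smul_compl {R : Mat2} (hh : R.IsHermitian) (hR : R * R = R) (x y : ℝ) :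
    (cayley ((x : ℂ) • R + (y : ℂ) • (1 - R)) : Mat2) =
      ((x - Complex.I) / (x + Complex.I)) • R + ((y - Complex.I) / (y + Complex.I)) • (1 - R) := by
  have hne : ∀ z : ℝ, (z : ℂ) + Complex.I ≠ 0 := fun z h => by
    simpa using congrArg Complex.im h
  have hne' : ∀ z : ℝ, (z : ℂ) - Complex.I ≠ 0 := fun z h => by
    simpa using congrArg Complex.im h
  have hadd : (x : ℂ) • R + (y : ℂ) • (1 - R) + Complex.I • (1 : Mat2) =
      (x + Complex.I) • R + (y + Complex.I) • (1 - R) := by module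
  have hsub : (x : ℂ) • R + (y : ℂ) • (1 - R) - Complex.I • (1 : Mat2) =
      (x - Complex.I) • R + (y - Complex.I) • (1 - R) := by module
  have hinv : ((x + Complex.I) • R + (y + Complex.I) • (1 - R))⁻¹ =
      (x + Complex.I)⁻¹ • R + (y + Complex.I)⁻¹ • (1 - R) := by
    apply Matrix.inv_eq_right_inv
    rw [smul_add_smul_compl_mul hR, mul_inv_cancel₀ (hne x), mul_inv_cancel₀ (hne y)]
    module
  have hmat : cayleyMat ((x : ℂ) • R + (y : ℂ) • (1 - R)) =
      ((x - Complex.I) / (x + Complex.I)) • R +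
        ((y - Complex.I) / (y + Complex.I)) • (1 - R) := by
    rw [cayleyMat, hadd, hsub, hinv, smul_add_smul_compl_mul hR, div_eq_mul_inv, div_eq_mul_inv]
  have hphase : ∀ z : ℝ, (z - Complex.I) / (z + Complex.I) *
      star ((z - Complex.I) / (z + Complex.I)) = 1 := fun z => by
    have h1 := hne z
    have h2 := hne' z
    simp only [Complex.star_def, map_div₀, map_sub, map_add, Complex.conj_ofReal, Complex.conj_I,
      sub_neg_eq_add, ← sub_eq_add_neg]
    field_simp
  have hmem : cayleyMat ((x : ℂ) • R + (y : ℂ) • (1 - R)) ∈ Matrix.unitaryGroup (Fin 2) ℂ := by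
    rw [Matrix.mem_unitaryGroup_iff, hmat]
    have hs : star R = R := hh
    rw [star_add, star_smul, star_smul, star_sub, star_one, hs, smul_add_smul_compl_mul hR,
      hphase, hphase]
    module
  rw [cayley, dif_pos hmem]
  exact hmat

lemma det_sub_smul_of_det_eq_zero {P : Mat2} (hd : P.det = 0) (ht : P.trace = 1) (V : Mat2)
    (a : ℂ) : (V - a • P).det = V.det - a * (V.trace - (P * V).trace) := by
  rw [Matrix.det_fin_two] at hd
  rw [Matrix.trace_fin_two] at ht
  simp only [Matrix.det_fin_two, Matrix.trace_fin_two, Matrix.mul_apply, Fin.sum_univ_two,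
    Matrix.sub_apply, Matrix.smul_apply, smul_eq_mul]
  linear_combination a ^ 2 * hd - a * (V 0 0 + V 1 1) * ht

lemma det_sub_smul_one (V : Mat2) (c : ℂ) :
    (V - c • (1 : Mat2)).det = V.det - c * V.trace + c ^ 2 := by
  simp [Matrix.det_fin_two, Matrix.trace_fin_two]
  ring

/-- The determinant, trace and `P`-weighted trace of `U + 1` characterise the unitaries `U` lying
on the three cones. -/
lemma coherentU_triple_iff {P : Mat2} (hP : IsProj1 P) (U : U2) :
    (CoherentU U (cayley ((1 / 2 : ℂ) • P)) ∧
       CoherentU U (cayley ((1 / 2 : ℂ) • ((1 : Mat2) - P))) ∧ CoherentU U (cayley 1)) ↔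
      ((U : Mat2) + 1).det = (-2 - 4 * Complex.I) / 5 ∧
      ((U : Mat2) + 1).trace = (6 - 8 * Complex.I) / 5 ∧
      (P * ((U : Mat2) + 1)).trace = (3 - 4 * Complex.I) / 5 := by
  have hI := Complex.I_sq
  have hhalf : (((1 / 2 : ℝ) : ℂ) - Complex.I) / (((1 / 2 : ℝ) : ℂ) + Complex.I) =
      -1 + (2 - 4 * Complex.I) / 5 := by
    rw [div_eq_iff (fun h => by simpa using congrArg Complex.im h)]
    push_cast
    linear_combination (4 / 5 : ℂ) * hI
  have hzero : (((0 : ℝ) : ℂ) - Complex.I) / (((0 : ℝ) : ℂ) + Complex.I) = -1 := by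
    simp
  have hone : (((1 : ℝ) : ℂ) - Complex.I) / (((1 : ℝ) : ℂ) + Complex.I) = -Complex.I := by
    rw [div_eq_iff (fun h => by simpa using congrArg Complex.im h)]
    push_cast
    linear_combination hI
  have e1 : (U : Mat2) - (cayley ((1 / 2 : ℂ) • P) : Mat2) =
      (U + 1) - ((2 - 4 * Complex.I) / 5) • P := by
    have h := coe_cayley_smul_add_smul_compl hP.1 hP.2.1 (1 / 2) 0
    rw [hhalf, hzero] at h
    rw [show (1 / 2 : ℂ) • P = ((1 / 2 : ℝ) : ℂ) • P + ((0 : ℝ) : ℂ) • (1 - P) by simp, h]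
    module
  have e2 : (U : Mat2) - (cayley ((1 / 2 : ℂ) • (1 - P)) : Mat2) =
      (U + 1) - ((2 - 4 * Complex.I) / 5) • (1 - P) := by
    have h := coe_cayley_smul_add_smul_compl hP.1 hP.2.1 0 (1 / 2)
    rw [hhalf, hzero] at h
    rw [show (1 / 2 : ℂ) • (1 - P) = ((0 : ℝ) : ℂ) • P + ((1 / 2 : ℝ) : ℂ) • (1 - P) by simp, h]
    module
  have e3 : (U : Mat2) - (cayley 1 : Mat2) = (U + 1) - (1 - Complex.I) • (1 : Mat2) := by
    have h := coe_cayley_smul_add_smul_compl hP.1 hP.2.1 1 1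
    rw [hone] at h
    rw [show (1 : Mat2) = ((1 : ℝ) : ℂ) • P + ((1 : ℝ) : ℂ) • (1 - P) by simp, h]
    simp only [Complex.ofReal_one]
    module
  have hdP := hP.det_eq_zero
  have htP := hP.trace_eq_one
  have hdP' : (1 - P).det = 0 := by
    have h := det_sub_smul_of_det_eq_zero hdP htP 1 1
    rw [one_smul, Matrix.det_one, mul_one, htP, Matrix.trace_one, Fintype.card_fin] at h
    rw [h]
    norm_num
  have htP' : (1 - P).trace = 1 := by
    rw [Matrix.trace_sub, htP]
    norm_num
  simp only [CoherentU, rank_le_one_iff_det_eq_zero]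
  rw [e1, e2, e3, det_sub_smul_of_det_eq_zero hdP htP, det_sub_smul_of_det_eq_zero hdP' htP',
    det_sub_smul_one, sub_mul, one_mul, Matrix.trace_sub]
  generalize ((U : Mat2) + 1).det = d
  generalize ((U : Mat2) + 1).trace = t
  generalize (P * ((U : Mat2) + 1)).trace = s
  have h5 : (2 - 4 * Complex.I) * (1 + 2 * Complex.I) = 10 := by linear_combination (-8 : ℂ) * hI
  constructor
  · rintro ⟨h1, h2, h3⟩
    have hs : s = d * (1 + 2 * Complex.I) / 2 := by
      linear_combination -(1 + 2 * Complex.I) / 2 * h2 - s / 10 * h5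
    have ht : t = d * (1 + 2 * Complex.I) := by
      linear_combination -(1 + 2 * Complex.I) / 2 * (h1 + h2) - t / 10 * h5
    have hd : d = (-2 - 4 * Complex.I) / 5 := by
      subst hs ht
      linear_combination (-(2 - Complex.I) / 5) * h3 +
        (4 / 5 - Complex.I / 5 + d - 2 / 5 * d * Complex.I) * hI
    refine ⟨hd, ?_, ?_⟩
    · rw [ht, hd]
      linear_combination (-8 / 5 : ℂ) * hI
    · rw [hs, hd]
      linear_combination (-4 / 5 : ℂ) * hI
  · rintro ⟨rfl, rfl, rfl⟩
    refine ⟨?_, ?_, ?_⟩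
    · linear_combination (-16 / 25 : ℂ) * hI
    · linear_combination (-16 / 25 : ℂ) * hI
    · linear_combination (-3 / 5 : ℂ) * hI

/-- The adjugate of a unitary matrix is its adjoint scaled by the determinant. -/
lemma det_smul_star_eq_adjugate (U : U2) :
    (U : Mat2).det • star (U : Mat2) = (U : Mat2).adjugate := by
  have h : star (U : Mat2) * (U : Mat2) = 1 := Matrix.mem_unitaryGroup_iff'.mp U.2
  calc (U : Mat2).det • star (U : Mat2)
      = star (U : Mat2) * ((U : Mat2) * (U : Mat2).adjugate) := by
        rw [Matrix.mul_adjugate, mul_smul_comm, mul_one]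
    _ = (U : Mat2).adjugate := by rw [← mul_assoc, h, one_mul]

lemma adjugate_eq_trace_smul_sub (A : Mat2) : A.adjugate = A.trace • (1 : Mat2) - A := by
  rw [Matrix.adjugate_fin_two, Matrix.trace_fin_two]
  ext i j
  fin_cases i <;> fin_cases j <;> simp

/-- The Cayley transform of `Q + (1/3)(1 - Q)`, shifted by the identity. -/
lemma coe_cayley_add_third_smul {Q : Mat2} (hh : Q.IsHermitian) (hQ : Q * Q = Q) :
    (cayley (Q + (1 / 3 : ℂ) • ((1 : Mat2) - Q)) : Mat2) + 1 =
      ((4 - 2 * Complex.I) / 5) • Q - (-(1 - 3 * Complex.I) / 5) • (1 : Mat2) := by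
  have hI := Complex.I_sq
  have hone : (((1 : ℝ) : ℂ) - Complex.I) / (((1 : ℝ) : ℂ) + Complex.I) = -Complex.I := by
    rw [div_eq_iff (fun h => by simpa using congrArg Complex.im h)]
    push_cast
    linear_combination hI
  have hthird : (((1 / 3 : ℝ) : ℂ) - Complex.I) / (((1 / 3 : ℝ) : ℂ) + Complex.I) =
      -(4 + 3 * Complex.I) / 5 := by
    rw [div_eq_iff (fun h => by simpa using congrArg Complex.im h)]
    push_cast
    linear_combination (3 / 5 : ℂ) * hI
  have h := coe_cayley_smul_add_smul_compl hh hQ 1 (1 / 3)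
  rw [hone, hthird] at h
  rw [show Q + (1 / 3 : ℂ) • ((1 : Mat2) - Q) =
    ((1 : ℝ) : ℂ) • Q + ((1 / 3 : ℝ) : ℂ) • (1 - Q) by simp, h]
  module

/-- The set of points of `U₂` coherent to `𝔠((1/2)P)`, `𝔠((1/2)P⊥)`, and `𝔠(I)` equals
`{𝔠(Q + (1/3)Q⊥) : Q a rank-one projection with tr(PQ) = 1/2}`. -/
theorem triple_intersection_of_cones
    (P : Mat2) (hP : IsProj1 P) :
    ∀ U : U2,
      (CoherentU U (cayley ((1 / 2 : ℂ) • P)) ∧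
       CoherentU U (cayley ((1 / 2 : ℂ) • ((1 : Mat2) - P))) ∧
       CoherentU U (cayley 1)) ↔
      (∃ Q : Mat2, IsProj1 Q ∧ (P * Q).trace = (1 / 2 : ℂ) ∧
        U = cayley (Q + (1 / 3 : ℂ) • ((1 : Mat2) - Q))) := by
  intro U
  have hI := Complex.I_sq
  rw [coherentU_triple_iff hP]
  constructor
  · rintro ⟨hd, ht, hs⟩
    have htU : (U : Mat2).trace = (-4 - 8 * Complex.I) / 5 := by
      rw [Matrix.trace_add, Matrix.trace_one, Fintype.card_fin] at ht
      push_cast at ht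
      linear_combination ht
    have hdU : (U : Mat2).det = (-3 + 4 * Complex.I) / 5 := by
      have h := det_sub_smul_one ((U : Mat2) + 1) 1
      rw [one_smul, add_sub_cancel_right, hd, ht] at h
      linear_combination h
    have hstar : star (U : Mat2) = ((-3 - 4 * Complex.I) / 5) •
        (((-4 - 8 * Complex.I) / 5) • (1 : Mat2) - U) := by
      rw [← htU, ← adjugate_eq_trace_smul_sub, ← det_smul_star_eq_adjugate, hdU, smul_smul,
        show (-3 - 4 * Complex.I) / 5 * ((-3 + 4 * Complex.I) / 5) = 1 by
          linear_combination (-16 / 25 : ℂ) * hI, one_smul]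
    have hQdef : ((2 + Complex.I) / 2) • ((U : Mat2) + 1 - ((1 - 3 * Complex.I) / 5) • (1 : Mat2))
        = ((2 + Complex.I) / 2) • (U : Mat2) + ((1 + 2 * Complex.I) / 2) • (1 : Mat2) := by
      match_scalars
      · ring
      · linear_combination (3 / 10 : ℂ) * hI
    set Q : Mat2 := ((2 + Complex.I) / 2) • ((U : Mat2) + 1 -
      ((1 - 3 * Complex.I) / 5) • (1 : Mat2)) with hQ
    have hherm : Q.IsHermitian := by
      change star Q = Q
      rw [hQdef, star_add, star_smul, star_smul, star_one, hstar]
      simp only [Complex.star_def, map_div₀, map_add, map_mul, map_one, Complex.conj_I, map_ofNat]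
      match_scalars
      · linear_combination (12 / 25 - 16 / 25 * Complex.I) * hI
      · linear_combination (-2 / 5 : ℂ) * hI
    have htr : Q.trace = 1 := by
      rw [hQ, Matrix.trace_smul, Matrix.trace_sub, ht, Matrix.trace_smul, Matrix.trace_one,
        Fintype.card_fin]
      simp only [smul_eq_mul]
      push_cast
      linear_combination (-1 / 5 : ℂ) * hI
    have hdet : Q.det = 0 := by
      rw [hQ, Matrix.det_smul, det_sub_smul_one, hd, ht]
      refine mul_eq_zero_of_right _ ?_
      linear_combination (-3 / 5 : ℂ) * hI
    have hproj := isProj1_of_trace_det hherm htr hdet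
    refine ⟨Q, hproj, ?_, ?_⟩
    · rw [hQ, mul_smul_comm, Matrix.trace_smul, mul_sub, Matrix.trace_sub, hs, mul_smul_comm,
        mul_one, Matrix.trace_smul, hP.trace_eq_one]
      simp only [smul_eq_mul]
      linear_combination (-1 / 10 : ℂ) * hI
    · apply Subtype.ext
      apply add_right_cancel (b := (1 : Mat2))
      rw [coe_cayley_add_third_smul hherm hproj.2.1, hQ, smul_smul,
        show (4 - 2 * Complex.I) / 5 * ((2 + Complex.I) / 2) = 1 by
          linear_combination (-1 / 5 : ℂ) * hI]
      module
  · rintro ⟨Q, hQ, hPQ, rfl⟩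
    have htQ := hQ.trace_eq_one
    rw [coe_cayley_add_third_smul hQ.1 hQ.2.1]
    refine ⟨?_, ?_, ?_⟩
    · rw [det_sub_smul_one, Matrix.det_smul, hQ.det_eq_zero, Matrix.trace_smul, htQ, smul_eq_mul]
      linear_combination (3 / 5 : ℂ) * hI
    · rw [Matrix.trace_sub, Matrix.trace_smul, htQ, Matrix.trace_smul, Matrix.trace_one,
        Fintype.card_fin]
      simp only [smul_eq_mul]
      push_cast
      ring
    · rw [mul_sub, mul_smul_comm, mul_smul_comm, mul_one, Matrix.trace_sub, Matrix.trace_smul,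
        Matrix.trace_smul, hPQ, hP.trace_eq_one]
      simp only [smul_eq_mul]
      ring
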